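/- Assume the coercivity condition (C) and the monotonicity assumption (M). Let λ > 0, let (z,k) ∈ 𝕋ⁿ×𝕀, and let v^λ be the unique viscosity solution of (P_λ). Then there exists μ^{z,k,λ} = (μ^{z,k,λ}_i)_{i∈𝕀} ∈ P(z,k,λ) such that v^λ_k(z) = Σ_{i∈𝕀} ⟨μ^{z,k,λ}_i, (λ+ρ_i)⁻¹L_i⟩, and this value is the minimum of Σ_{i∈𝕀} ⟨μ_i, (λ+ρ_i)⁻¹L_i⟩ over all μ = (μ_i)_{i∈𝕀} ∈ P(z,k,λ). -/

import Mathlib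

open MeasureTheory Filter Topology RealInnerProductSpace

noncomputable section

/-- Euclidean space ℝⁿ, the universal cover of the flat torus 𝕋ⁿ = ℝⁿ/ℤⁿ. -/
abbrev Euc (n : ℕ) := EuclideanSpace ℝ (Fin n)

/-- A vector of ℝⁿ with integer coordinates (an element of ℤⁿ). -/
def IsIntVec {n : ℕ} (z : Euc n) : Prop := ∀ i, ∃ k : ℤ, z i = (k : ℝ)

/-- ℤⁿ-periodic functions on ℝⁿ: these represent functions on the torus 𝕋ⁿ. -/
def TorusFun {n : ℕ} {α : Type*} (f : Euc n → α) : Prop :=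
  ∀ (x z : Euc n), IsIntVec z → f (x + z) = f x

/-- Functions on 𝕋ⁿ × Ξ, i.e. ℤⁿ-periodic in the first variable. -/
def TorusFun2 {n : ℕ} {Ξ : Type*} {α : Type*} (f : Euc n × Ξ → α) : Prop :=
  ∀ (x z : Euc n) (ξ : Ξ), IsIntVec z → f (x + z, ξ) = f (x, ξ)

/-- The Hamiltonian H_{φ,i}(x,p) = sup_{ξ∈Ξ} (−g_i(x,ξ)·p − φ_i(x,ξ)). -/
def ham {n m : ℕ} {Ξ : Type*} (g : Fin m → Euc n × Ξ → Euc n)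
    (φ : Fin m → Euc n × Ξ → ℝ) (i : Fin m) (x p : Euc n) : ℝ :=
  ⨆ ξ : Ξ, (-⟪g i (x, ξ), p⟫ - φ i (x, ξ))

/-- The data g = (g_i), L = (L_i) consist of continuous functions on 𝕋ⁿ × Ξ. -/
def GoodData {n m : ℕ} {Ξ : Type*} [TopologicalSpace Ξ]
    (g : Fin m → Euc n × Ξ → Euc n) (L : Fin m → Euc n × Ξ → ℝ) : Prop :=
  (∀ i, Continuous (g i) ∧ TorusFun2 (g i)) ∧ (∀ i, Continuous (L i) ∧ TorusFun2 (L i))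

/-- Coercivity (C): min_{x∈𝕋ⁿ} H_i(x,p) → ∞ as |p| → ∞. -/
def Coercive {n m : ℕ} {Ξ : Type*} (g : Fin m → Euc n × Ξ → Euc n)
    (L : Fin m → Euc n × Ξ → ℝ) : Prop :=
  ∀ (i : Fin m) (M : ℝ), ∃ R : ℝ, ∀ p : Euc n, R ≤ ‖p‖ → ∀ x : Euc n, M ≤ ham g L i x p

/-- A monotone m×m real matrix. -/
def IsMonotoneMat {m : ℕ} (B : Matrix (Fin m) (Fin m) ℝ) : Prop :=
  ∀ (u : Fin m → ℝ) (k : Fin m), (∀ i, u i ≤ u k) → 0 ≤ u k → 0 ≤ ∑ j, B k j * u j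

/-- Assumption (M): B(x) has continuous entries (as functions on 𝕋ⁿ) and is monotone
for every x. -/
def GoodCoupling {n m : ℕ} (B : Euc n → Matrix (Fin m) (Fin m) ℝ) : Prop :=
  (∀ i j, Continuous (fun x => B x i j) ∧ TorusFun (fun x => B x i j)) ∧
    ∀ x, IsMonotoneMat (B x)

/-- Viscosity subsolution of λu + Bu + H_φ[u] = c in 𝕋ⁿ. -/
def IsSubsol {n m : ℕ} {Ξ : Type*} (B : Euc n → Matrix (Fin m) (Fin m) ℝ) (lam : ℝ)
    (g : Fin m → Euc n × Ξ → Euc n) (φ : Fin m → Euc n × Ξ → ℝ)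
    (c : Fin m → ℝ) (u : Fin m → Euc n → ℝ) : Prop :=
  (∀ i, UpperSemicontinuous (u i) ∧ TorusFun (u i)) ∧
    ∀ (i : Fin m) (ψ : Euc n → ℝ), ContDiff ℝ 1 ψ → TorusFun ψ →
      ∀ x : Euc n, IsLocalMax (fun y => u i y - ψ y) x →
        lam * u i x + (∑ j, B x i j * u j x) + ham g φ i x (gradient ψ x) ≤ c i

/-- Viscosity supersolution of λu + Bu + H_φ[u] = c in 𝕋ⁿ. -/
def IsSupersol {n m : ℕ} {Ξ : Type*} (B : Euc n → Matrix (Fin m) (Fin m) ℝ) (lam : ℝ)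
    (g : Fin m → Euc n × Ξ → Euc n) (φ : Fin m → Euc n × Ξ → ℝ)
    (c : Fin m → ℝ) (u : Fin m → Euc n → ℝ) : Prop :=
  (∀ i, LowerSemicontinuous (u i) ∧ TorusFun (u i)) ∧
    ∀ (i : Fin m) (ψ : Euc n → ℝ), ContDiff ℝ 1 ψ → TorusFun ψ →
      ∀ x : Euc n, IsLocalMin (fun y => u i y - ψ y) x →
        c i ≤ lam * u i x + (∑ j, B x i j * u j x) + ham g φ i x (gradient ψ x)

/-- Viscosity solution of λu + Bu + H_φ[u] = c in 𝕋ⁿ. -/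
def IsSol {n m : ℕ} {Ξ : Type*} (B : Euc n → Matrix (Fin m) (Fin m) ℝ) (lam : ℝ)
    (g : Fin m → Euc n × Ξ → Euc n) (φ : Fin m → Euc n × Ξ → ℝ)
    (c : Fin m → ℝ) (u : Fin m → Euc n → ℝ) : Prop :=
  (∀ i, Continuous (u i)) ∧ IsSubsol B lam g φ c u ∧ IsSupersol B lam g φ c u

/-- (φ,u) ∈ F(λ): φ ∈ C(𝕋ⁿ×Ξ)ᵐ, u ∈ C(𝕋ⁿ)ᵐ and u is a viscosity subsolution of
B^λ u + H_φ[u] = 0 in 𝕋ⁿ. -/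
def memF {n m : ℕ} {Ξ : Type*} [TopologicalSpace Ξ]
    (B : Euc n → Matrix (Fin m) (Fin m) ℝ) (lam : ℝ)
    (g : Fin m → Euc n × Ξ → Euc n)
    (φ : Fin m → Euc n × Ξ → ℝ) (u : Fin m → Euc n → ℝ) : Prop :=
  (∀ i, Continuous (φ i) ∧ TorusFun2 (φ i)) ∧ (∀ i, Continuous (u i)) ∧
    IsSubsol B lam g φ (fun _ => 0) u

/-- ρ_i(x) = Σ_j b_{ij}(x). -/
def rhoB {n m : ℕ} (B : Euc n → Matrix (Fin m) (Fin m) ℝ) (i : Fin m) (x : Euc n) : ℝ :=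
  ∑ j, B x i j

/-- ν ∈ P_{B^λ}: a family of finite nonnegative Borel measures with ⟨ν, B^λ1⟩ = 1. -/
def memPB {n m : ℕ} {Ξ : Type*} [MeasurableSpace Ξ]
    (B : Euc n → Matrix (Fin m) (Fin m) ℝ) (lam : ℝ)
    (ν : Fin m → Measure (Euc n × Ξ)) : Prop :=
  (∀ i, IsFiniteMeasure (ν i)) ∧
    (∑ i, ∫ q, (lam + rhoB B i q.1) ∂(ν i)) = 1

/-- ν ∈ G'(z,k,λ): ν ∈ P_{B^λ} and ⟨ν, φ − u_k(z) B^λ1⟩ ≥ 0 for every (φ,u) ∈ F(λ). -/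
def memGP {n m : ℕ} {Ξ : Type*} [TopologicalSpace Ξ] [MeasurableSpace Ξ]
    (B : Euc n → Matrix (Fin m) (Fin m) ℝ) (lam : ℝ)
    (g : Fin m → Euc n × Ξ → Euc n) (z : Euc n) (k : Fin m)
    (ν : Fin m → Measure (Euc n × Ξ)) : Prop :=
  memPB B lam ν ∧
    ∀ φ u, memF B lam g φ u →
      0 ≤ ∑ i, ∫ q, (φ i q - u k z * (lam + rhoB B i q.1)) ∂(ν i)

/-- μ ∈ P: a family of nonnegative Borel measures of total mass 1. -/
def memP {n m : ℕ} {Ξ : Type*} [MeasurableSpace Ξ]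
    (μ : Fin m → Measure (Euc n × Ξ)) : Prop :=
  (∀ i, IsFiniteMeasure (μ i)) ∧ (∑ i, (μ i Set.univ).toReal) = 1

/-- μ ∈ P(z,k,λ): μ ∈ P and Σ_i ⟨μ_i, (λ+ρ_i)⁻¹ φ_i⟩ ≥ u_k(z) for all (φ,u) ∈ F(λ). -/
def memPzk {n m : ℕ} {Ξ : Type*} [TopologicalSpace Ξ] [MeasurableSpace Ξ]
    (B : Euc n → Matrix (Fin m) (Fin m) ℝ) (lam : ℝ)
    (g : Fin m → Euc n × Ξ → Euc n) (z : Euc n) (k : Fin m)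
    (μ : Fin m → Measure (Euc n × Ξ)) : Prop :=
  memP μ ∧
    ∀ φ u, memF B lam g φ u →
      u k z ≤ ∑ i, ∫ q, (lam + rhoB B i q.1)⁻¹ * φ i q ∂(μ i)

/-- μ ∈ P(0): μ ∈ P and ⟨μ,φ⟩ ≥ 0 for all (φ,u) ∈ F(0). -/
def memP0 {n m : ℕ} {Ξ : Type*} [TopologicalSpace Ξ] [MeasurableSpace Ξ]
    (B : Euc n → Matrix (Fin m) (Fin m) ℝ)
    (g : Fin m → Euc n × Ξ → Euc n)
    (μ : Fin m → Measure (Euc n × Ξ)) : Prop :=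
  memP μ ∧ ∀ φ u, memF B 0 g φ u → 0 ≤ ∑ i, ∫ q, φ i q ∂(μ i)

/-- μ ∈ M₊(0): a family of finite nonnegative Borel measures with ⟨μ,φ⟩ ≥ 0 for all
(φ,u) ∈ F(0). -/
def memM0 {n m : ℕ} {Ξ : Type*} [TopologicalSpace Ξ] [MeasurableSpace Ξ]
    (B : Euc n → Matrix (Fin m) (Fin m) ℝ)
    (g : Fin m → Euc n × Ξ → Euc n)
    (μ : Fin m → Measure (Euc n × Ξ)) : Prop :=
  (∀ i, IsFiniteMeasure (μ i)) ∧ ∀ φ u, memF B 0 g φ u → 0 ≤ ∑ i, ∫ q, φ i q ∂(μ i)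

/-- Assumption (E): problem (P₀) has a Lipschitz continuous viscosity solution. -/
def AssumptionE {n m : ℕ} {Ξ : Type*} (B : Euc n → Matrix (Fin m) (Fin m) ℝ)
    (g : Fin m → Euc n × Ξ → Euc n) (L : Fin m → Euc n × Ξ → ℝ) : Prop :=
  ∃ v₀ : Fin m → Euc n → ℝ, (∀ i, ∃ K : NNReal, LipschitzWith K (v₀ i)) ∧
    IsSol B 0 g L (fun _ => 0) v₀

end



noncomputable def thetaF {n : ℕ} (x : Euc n) : ℝ := ∑ i, (1 - Real.cos (2 * Real.pi * x i))

lemma theta_contDiff {n : ℕ} : ContDiff ℝ 1 (thetaF (n := n)) := by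
  unfold thetaF
  refine ContDiff.sum fun i _ => ?_
  have : ContDiff ℝ 1 (fun x : Euc n => x i) := by fun_prop
  exact contDiff_const.sub (Real.contDiff_cos.comp (contDiff_const.mul this))

lemma theta_periodic {n : ℕ} : TorusFun (thetaF (n := n)) := by
  intro x z hz
  unfold thetaF
  refine Finset.sum_congr rfl fun i _ => ?_
  obtain ⟨k, hk⟩ := hz i
  have : 2 * Real.pi * (x + z) i = 2 * Real.pi * x i + k * (2 * Real.pi) := by
    rw [PiLp.add_apply, hk]; ring
  rw [this, Real.cos_add_int_mul_two_pi]

lemma theta_nonneg {n : ℕ} (x : Euc n) : 0 ≤ thetaF x :=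
  Finset.sum_nonneg fun i _ => by linarith [Real.cos_le_one (2 * Real.pi * x i)]

lemma theta_zero {n : ℕ} : thetaF (0 : Euc n) = 0 := by simp [thetaF]

lemma theta_eq_zero {n : ℕ} (x : Euc n) (h : thetaF x = 0) (hx : ‖x‖ < 1) : x = 0 := by
  ext i
  have h1 := (Finset.sum_eq_zero_iff_of_nonneg
    (fun i _ => by linarith [Real.cos_le_one (2 * Real.pi * x i)])).1 h i (Finset.mem_univ i)
  have h2 : Real.cos (2 * Real.pi * x i) = 1 := by linarith
  obtain ⟨k, hk⟩ := (Real.cos_eq_one_iff _).1 h2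
  have h3 : (k : ℝ) = x i := by
    have := Real.pi_pos
    have h4 : (2 * Real.pi) * ((k : ℝ) - x i) = 0 := by linarith
    rcases mul_eq_zero.1 h4 with h | h <;> linarith
  have h5 : |(k : ℝ)| < 1 := by rw [h3]; exact lt_of_le_of_lt (PiLp.norm_apply_le x i) hx
  have h6 : |k| < 1 := by exact_mod_cast h5
  have : k = 0 := Int.abs_lt_one_iff.1 h6
  simp [← h3, this]

lemma grad_cont {n : ℕ} {f : Euc n → ℝ} (hf : ContDiff ℝ 1 f) : Continuous (gradient f) := by
  unfold gradient
  exact (LinearIsometryEquiv.continuous _).comp (hf.continuous_fderiv one_ne_zero)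

lemma grad_has {n : ℕ} {f : Euc n → ℝ} (hf : ContDiff ℝ 1 f) (x : Euc n) :
    HasGradientAt f (gradient f x) x :=
  (hf.differentiable one_ne_zero x).hasGradientAt

lemma grad_theta_zero {n : ℕ} : gradient (thetaF (n := n)) 0 = 0 := by
  have : IsLocalMin (thetaF (n := n)) 0 := Filter.Eventually.of_forall fun x => by
    rw [theta_zero]; exact theta_nonneg x
  unfold gradient
  rw [this.fderiv_eq_zero]; simp

lemma grad_psi1 {n : ℕ} {ψ : Euc n → ℝ} (hψ : ContDiff ℝ 1 ψ) (x0 y x : Euc n) (N : ℝ) :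
    gradient (fun t => ψ t + thetaF (t - x0) + N * thetaF (t - y)) x =
      gradient ψ x + gradient thetaF (x - x0) + N • gradient thetaF (x - y) := by
  apply HasGradientAt.gradient
  have h1 := (grad_has hψ x).hasFDerivAt
  have h2 := (grad_has (theta_contDiff (n := n)) (x - x0)).hasFDerivAt
  have h3 := (grad_has (theta_contDiff (n := n)) (x - y)).hasFDerivAt
  have e0 : HasFDerivAt (fun t : Euc n => t - x0) (ContinuousLinearMap.id ℝ _) x :=
    (hasFDerivAt_id x).sub_const x0
  have e1 : HasFDerivAt (fun t : Euc n => t - y) (ContinuousLinearMap.id ℝ _) x :=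
    (hasFDerivAt_id x).sub_const y
  have := (h1.add (h2.comp x e0)).add ((h3.comp x e1).const_mul N)
  rw [hasGradientAt_iff_hasFDerivAt]
  refine this.congr_fderiv ?_
  ext v
  simp

lemma grad_psi2 {n : ℕ} (x y : Euc n) (N : ℝ) :
    gradient (fun t => N * thetaF (x - t)) y = -(N • gradient thetaF (x - y)) := by
  apply HasGradientAt.gradient
  have h3 := (grad_has (theta_contDiff (n := n)) (x - y)).hasFDerivAt
  have e1 : HasFDerivAt (fun t : Euc n => x - t) (-ContinuousLinearMap.id ℝ _) y :=
    (hasFDerivAt_id y).const_sub x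
  have := ((h3.comp y e1).const_mul N)
  rw [hasGradientAt_iff_hasFDerivAt]
  refine this.congr_fderiv ?_
  ext v
  simp

lemma doubling {n : ℕ} {a b : Euc n → ℝ} (ha : Continuous a) (hb : Continuous b)
    {ψ : Euc n → ℝ} (hψ : ContDiff ℝ 1 ψ) (hψp : TorusFun ψ) (x0 : Euc n)
    (hmax : IsLocalMax (fun y => a y + b y - ψ y) x0)
    (F1 F2 : Euc n → Euc n → ℝ)
    (hF1 : Continuous (fun q : Euc n × Euc n => F1 q.1 q.2))
    (hF2 : Continuous (fun q : Euc n × Euc n => F2 q.1 q.2))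
    (h1 : ∀ ψ : Euc n → ℝ, ContDiff ℝ 1 ψ → TorusFun ψ → ∀ x,
      IsLocalMax (fun y => a y - ψ y) x → F1 x (gradient ψ x) ≤ 0)
    (h2 : ∀ ψ : Euc n → ℝ, ContDiff ℝ 1 ψ → TorusFun ψ → ∀ x,
      IsLocalMax (fun y => b y - ψ y) x → F2 x (gradient ψ x) ≤ 0)
    (R : ℝ) (hR : ∀ x p, R ≤ ‖p‖ → 0 < F1 x p) :
    ∃ p, F1 x0 (gradient ψ x0 + p) ≤ 0 ∧ F2 x0 (-p) ≤ 0 := by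
  obtain ⟨r', hr', hr'b⟩ := Metric.eventually_nhds_iff.1 hmax
  obtain ⟨r, hr, hrr, hrh⟩ : ∃ r > 0, r < r' ∧ r < 1 / 2 :=
    ⟨min r' (1/2) / 2, by positivity, by
      have := min_le_left r' (1/2); linarith, by
      have := min_le_right r' (1/2); linarith⟩
  have hcψ := hψ.continuous
  have hcθ : Continuous (thetaF (n := n)) := theta_contDiff.continuous
  have hgθ := grad_cont (theta_contDiff (n := n))
  have hgψ := grad_cont hψ
  set K := Metric.closedBall x0 r with hK
  have hKc : IsCompact (K ×ˢ K) := (isCompact_closedBall x0 r).prod (isCompact_closedBall x0 r)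
  have hx0K : x0 ∈ K := Metric.mem_closedBall_self hr.le
  set Ψ : Euc n × Euc n → ℝ := fun q => a q.1 + b q.2 - ψ q.1 - thetaF (q.1 - x0) with hΨ
  have hΨc : Continuous Ψ := by fun_prop
  have hex : ∀ N : ℕ, ∃ q ∈ K ×ˢ K, IsMaxOn (fun q : Euc n × Euc n =>
      Ψ q - N * thetaF (q.1 - q.2)) (K ×ˢ K) q := fun N =>
    hKc.exists_isMaxOn ⟨(x0, x0), hx0K, hx0K⟩ (by fun_prop)
  choose q hqK hqm using hex
  obtain ⟨qb, hqbK, s, hs, hsl⟩ := hKc.tendsto_subseq hqK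
  obtain ⟨C, hC⟩ := hKc.bddAbove_image hΨc.continuousOn
  have hM : ∀ N, Ψ (x0, x0) ≤ Ψ (q N) - N * thetaF ((q N).1 - (q N).2) := fun N => by
    have := hqm N (show (x0, x0) ∈ K ×ˢ K from ⟨hx0K, hx0K⟩)
    simpa [theta_zero] using this
  have hθl : Tendsto (fun j => thetaF ((q (s j)).1 - (q (s j)).2)) atTop
      (𝓝 (thetaF (qb.1 - qb.2))) :=
    ((hcθ.comp (continuous_fst.sub continuous_snd)).tendsto qb).comp hsl
  have hθz : Tendsto (fun j => thetaF ((q (s j)).1 - (q (s j)).2)) atTop (𝓝 0) := by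
    have ht : Tendsto (fun j => (C - Ψ (x0, x0)) / ((s j : ℕ) : ℝ)) atTop (𝓝 0) :=
      (tendsto_const_div_atTop_nhds_zero_nat (C - Ψ (x0, x0))).comp hs.tendsto_atTop
    refine tendsto_of_tendsto_of_tendsto_of_le_of_le' tendsto_const_nhds ht
      (Eventually.of_forall fun j => theta_nonneg _) ?_
    filter_upwards [hs.tendsto_atTop.eventually_gt_atTop 0] with j hj
    have hj' : (0 : ℝ) < (s j : ℕ) := by exact_mod_cast hj
    rw [le_div_iff₀ hj']
    have e1 := hM (s j)
    have e2 := hC (Set.mem_image_of_mem _ (hqK (s j)))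
    linarith
  have hd : qb.1 = qb.2 := by
    have e := tendsto_nhds_unique hθl hθz
    have e2 : ‖qb.1 - qb.2‖ < 1 := by
      rw [← dist_eq_norm]
      have := dist_triangle_right qb.1 qb.2 x0
      have a1 := Metric.mem_closedBall.1 hqbK.1
      have a2 := Metric.mem_closedBall.1 hqbK.2
      linarith
    exact sub_eq_zero.1 (theta_eq_zero _ e e2)
  have hq1 : qb.1 = x0 := by
    have e1 : Ψ (x0, x0) ≤ Ψ qb := by
      refine ge_of_tendsto ((hΨc.tendsto qb).comp hsl) (Eventually.of_forall fun j => ?_)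
      have := hM (s j)
      have h3 := mul_nonneg (Nat.cast_nonneg (α := ℝ) (s j)) (theta_nonneg ((q (s j)).1 - (q (s j)).2))
      simp only [Function.comp]
      linarith
    have a1 := Metric.mem_closedBall.1 hqbK.1
    have e2 := hr'b (lt_of_le_of_lt a1 hrr)
    simp only [hΨ, ← hd, sub_self, theta_zero] at e1
    have e3 : thetaF (qb.1 - x0) = 0 := le_antisymm (by linarith) (theta_nonneg _)
    refine sub_eq_zero.1 (theta_eq_zero _ e3 ?_)
    rw [← dist_eq_norm]; linarith
  have hqb : qb = (x0, x0) := Prod.ext hq1 (hd ▸ hq1)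
  subst hqb
  have hl1 : Tendsto (fun j => (q (s j)).1) atTop (𝓝 x0) :=
    (continuous_fst.tendsto _).comp hsl
  have hl2 : Tendsto (fun j => (q (s j)).2) atTop (𝓝 x0) :=
    (continuous_snd.tendsto _).comp hsl
  have hKn : Metric.ball x0 r ∈ 𝓝 x0 := Metric.ball_mem_nhds _ hr
  set pp : ℕ → Euc n := fun j => ((s j : ℕ) : ℝ) • gradient thetaF ((q (s j)).1 - (q (s j)).2)
    with hpp
  set PP : ℕ → Euc n := fun j => gradient ψ (q (s j)).1 + gradient thetaF ((q (s j)).1 - x0)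
    + pp j with hPP
  have key : ∀ᶠ j in atTop, F1 (q (s j)).1 (PP j) ≤ 0 ∧ F2 (q (s j)).2 (-(pp j)) ≤ 0 := by
    filter_upwards [hl1 hKn, hl2 hKn] with j hj1 hj2
    have hj1 : (q (s j)).1 ∈ Metric.ball x0 r := hj1
    have hj2 : (q (s j)).2 ∈ Metric.ball x0 r := hj2
    have hm := hqm (s j)
    have hk := hqK (s j)
    constructor
    · have := h1 (fun t => ψ t + thetaF (t - x0) + (s j : ℕ) * thetaF (t - (q (s j)).2))
        (by
          have := theta_contDiff (n := n)
          exact (hψ.add (this.comp (contDiff_id.sub contDiff_const))).add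
            (contDiff_const.mul (this.comp (contDiff_id.sub contDiff_const))))
        (by
          intro x w hw
          have e1 := theta_periodic (x - x0) w hw
          have e2 := theta_periodic (x - (q (s j)).2) w hw
          simp only [hψp x w hw]
          rw [add_sub_right_comm, e1, add_sub_right_comm, e2])
        (q (s j)).1 (by
          filter_upwards [Metric.isOpen_ball.mem_nhds hj1] with t ht
          have := hm (show (t, (q (s j)).2) ∈ K ×ˢ K from ⟨Metric.ball_subset_closedBall ht, hk.2⟩)
          simp only [Set.mem_ofPred_eq, hΨ] at this
          linarith)
      rwa [grad_psi1 hψ] at this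
    · have := h2 (fun t => (s j : ℕ) * thetaF ((q (s j)).1 - t))
        (by
          have := theta_contDiff (n := n)
          exact (contDiff_const.mul (this.comp (contDiff_const.sub contDiff_id))))
        (by
          intro x w hw
          have e2 := theta_periodic ((q (s j)).1 - (x + w)) w hw
          have : (q (s j)).1 - (x + w) + w = (q (s j)).1 - x := by abel
          rw [this] at e2
          simp only [e2])
        (q (s j)).2 (by
          filter_upwards [Metric.isOpen_ball.mem_nhds hj2] with t ht
          have := hm (show ((q (s j)).1, t) ∈ K ×ˢ K from ⟨hk.1, Metric.ball_subset_closedBall ht⟩)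
          simp only [Set.mem_ofPred_eq, hΨ] at this
          linarith)
      rwa [grad_psi2] at this
  have hPPb : ∀ᶠ j in atTop, PP j ∈ Metric.closedBall (0 : Euc n) R := by
    filter_upwards [key] with j hj
    rw [mem_closedBall_zero_iff]
    by_contra hcon
    exact absurd hj.1 (not_le.2 (hR _ _ (not_le.1 hcon).le))
  obtain ⟨P, -, s', hs', hPl⟩ := (isCompact_closedBall (0 : Euc n) R).tendsto_subseq' hPPb.frequently
  have hs't := hs'.tendsto_atTop
  have hl1' := hl1.comp hs't
  have hl2' := hl2.comp hs't
  have hppl : Tendsto (fun j => -(pp (s' j))) atTop (𝓝 (-(P - gradient ψ x0))) := by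
    have e1 : Tendsto (fun j => gradient ψ (q (s (s' j))).1) atTop (𝓝 (gradient ψ x0)) :=
      (hgψ.tendsto x0).comp hl1'
    have e2 : Tendsto (fun j => gradient thetaF ((q (s (s' j))).1 - x0)) atTop (𝓝 0) := by
      have hc : Continuous (fun t : Euc n => gradient thetaF (t - x0)) := by fun_prop
      have := (hc.tendsto x0).comp hl1'
      simpa [Function.comp_def, grad_theta_zero] using this
    have e3 := (e1.add e2).sub hPl
    have e4 : -(P - gradient ψ x0) = gradient ψ x0 + 0 - P := by abel
    rw [e4]
    refine e3.congr fun j => ?_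
    simp only [hPP, Function.comp]
    abel
  refine ⟨P - gradient ψ x0, ?_, ?_⟩
  · rw [add_sub_cancel]
    refine le_of_tendsto ((hF1.tendsto (x0, P)).comp (hl1'.prodMk_nhds hPl)) ?_
    filter_upwards [hs't.eventually key] with j hj
    exact hj.1
  · refine le_of_tendsto ((hF2.tendsto (x0, -(P - gradient ψ x0))).comp (hl2'.prodMk_nhds hppl)) ?_
    filter_upwards [hs't.eventually key] with j hj
    exact hj.2

section hamLemmas
set_option linter.unusedSectionVars false
variable {n m : ℕ} {Ξ : Type*} [MetricSpace Ξ] [CompactSpace Ξ] [Nonempty Ξ]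

lemma le_ham {g : Fin m → Euc n × Ξ → Euc n} {φ : Fin m → Euc n × Ξ → ℝ}
    (i : Fin m) (hg : Continuous (g i)) (hφ : Continuous (φ i)) (x p : Euc n) (ξ : Ξ) :
    -⟪g i (x, ξ), p⟫ - φ i (x, ξ) ≤ ham g φ i x p := by
  unfold ham
  refine le_ciSup (f := fun ξ : Ξ => -⟪g i (x, ξ), p⟫ - φ i (x, ξ)) ?_ ξ
  exact (isCompact_range (by fun_prop)).bddAbove

lemma ham_le {g : Fin m → Euc n × Ξ → Euc n} {φ : Fin m → Euc n × Ξ → ℝ}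
    (i : Fin m) (x p : Euc n) (c : ℝ) (h : ∀ ξ, -⟪g i (x, ξ), p⟫ - φ i (x, ξ) ≤ c) :
    ham g φ i x p ≤ c := ciSup_le h

lemma ham_cont {g : Fin m → Euc n × Ξ → Euc n} {φ : Fin m → Euc n × Ξ → ℝ}
    (i : Fin m) (hg : Continuous (g i)) (hφ : Continuous (φ i)) :
    Continuous (fun q : Euc n × Euc n => ham g φ i q.1 q.2) := by
  have := IsCompact.continuous_sSup (K := (Set.univ : Set Ξ)) isCompact_univ
    (f := fun (q : Euc n × Euc n) (ξ : Ξ) => -⟪g i (q.1, ξ), q.2⟫ - φ i (q.1, ξ))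
    (by
      simp only [Function.HasUncurry.uncurry, id]
      fun_prop)
  simpa [Set.image_univ, sSup_range, ham] using this

def cubeK (n : ℕ) : Set (Euc n) := {x | ∀ i, x i ∈ Set.Icc (0 : ℝ) 1}

lemma cubeK_compact : IsCompact (cubeK n) := by
  have h : cubeK n = (WithLp.toLp 2) '' (Set.pi Set.univ (fun _ : Fin n => Set.Icc (0 : ℝ) 1)) := by
    ext x
    constructor
    · intro hx
      exact ⟨WithLp.ofLp x, fun i _ => hx i, rfl⟩
    · rintro ⟨y, hy, rfl⟩ i
      exact hy i (Set.mem_univ i)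
  rw [h]
  exact (isCompact_univ_pi fun i => isCompact_Icc).image (PiLp.continuous_toLp 2 _)

lemma cubeK_zero : (0 : Euc n) ∈ cubeK n := fun i => by simp

lemma cubeK_shift (x : Euc n) : ∃ w : Euc n, IsIntVec w ∧ x + w ∈ cubeK n := by
  refine ⟨WithLp.toLp 2 (fun i => -(⌊x i⌋ : ℝ)), fun i => ⟨-⌊x i⌋, by simp⟩, fun i => ?_⟩
  have h1 := Int.floor_le (x i)
  have h2 := (Int.lt_floor_add_one (x i)).le
  simp only [PiLp.add_apply]
  constructor <;> linarith

lemma periodic_argmax (hm : 0 < m) (f : Fin m → Euc n → ℝ) (hf : ∀ i, Continuous (f i))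
    (hp : ∀ i, TorusFun (f i)) : ∃ i x, ∀ j y, f j y ≤ f i x := by
  haveI : Nonempty (Fin m) := ⟨⟨0, hm⟩⟩
  have h1 : ∀ i, ∃ x ∈ cubeK n, IsMaxOn (f i) (cubeK n) x := fun i =>
    cubeK_compact.exists_isMaxOn ⟨0, cubeK_zero⟩ (hf i).continuousOn
  choose x hxK hxm using h1
  obtain ⟨i, hi⟩ := Finite.exists_max (fun i => f i (x i))
  refine ⟨i, x i, fun j y => ?_⟩
  obtain ⟨w, hw, hyw⟩ := cubeK_shift y
  rw [← hp j y w hw]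
  exact (hxm j hyw).trans (hi j)

lemma periodic_bdd2 (f : Euc n × Ξ → ℝ) (hf : Continuous f) (hp : TorusFun2 f) :
    ∃ C, ∀ q, |f q| ≤ C := by
  obtain ⟨C, hC⟩ := ((cubeK_compact (n := n)).prod (isCompact_univ (X := Ξ))).exists_bound_of_continuousOn
    hf.continuousOn
  refine ⟨C, fun q => ?_⟩
  obtain ⟨w, hw, hyw⟩ := cubeK_shift q.1
  have := hC (q.1 + w, q.2) ⟨hyw, Set.mem_univ _⟩
  rwa [hp q.1 w q.2 hw] at this

lemma periodic_bdd (f : Euc n → ℝ) (hf : Continuous f) (hp : TorusFun f) :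
    ∃ C, ∀ q, |f q| ≤ C := by
  obtain ⟨C, hC⟩ := (cubeK_compact (n := n)).exists_bound_of_continuousOn hf.continuousOn
  refine ⟨C, fun q => ?_⟩
  obtain ⟨w, hw, hyw⟩ := cubeK_shift q
  have := hC (q + w) hyw
  rwa [hp q w hw] at this

lemma coer_bound {g : Fin m → Euc n × Ξ → Euc n} {L φ : Fin m → Euc n × Ξ → ℝ}
    (hgL : GoodData g L) (hcoer : Coercive g L)
    {B : Euc n → Matrix (Fin m) (Fin m) ℝ} (hB : GoodCoupling B)
    (lam : ℝ) (hφ : ∀ i, Continuous (φ i) ∧ TorusFun2 (φ i))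
    {u : Fin m → Euc n → ℝ} (hu : ∀ i, Continuous (u i)) (hup : ∀ i, TorusFun (u i)) (i : Fin m) :
    ∃ R, ∀ x p, R ≤ ‖p‖ → 0 < lam * u i x + (∑ j, B x i j * u j x) + ham g φ i x p := by
  obtain ⟨C1, hC1⟩ := periodic_bdd2 (L i) (hgL.2 i).1 (hgL.2 i).2
  obtain ⟨C2, hC2⟩ := periodic_bdd2 (φ i) (hφ i).1 (hφ i).2
  obtain ⟨D, hD⟩ := periodic_bdd (fun x => lam * u i x + (∑ j, B x i j * u j x))
    (by
      have := fun j => (hB.1 i j).1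
      fun_prop)
    (by
      intro x w hw
      simp only [hup _ x w hw]
      congr 1
      exact Finset.sum_congr rfl fun j _ => by
        have : B (x + w) i j = B x i j := (hB.1 i j).2 x w hw
        rw [this])
  obtain ⟨R, hR⟩ := hcoer i (C1 + C2 + D + 1)
  refine ⟨R, fun x p hp => ?_⟩
  have h1 := hR p hp x
  have h2 : ham g L i x p ≤ ham g φ i x p + C1 + C2 := by
    refine ham_le i x p _ fun ξ => ?_
    have a1 := le_ham i (hgL.1 i).1 (hφ i).1 x p ξ
    have a2 := abs_le.1 (hC1 (x, ξ))
    have a3 := abs_le.1 (hC2 (x, ξ))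
    linarith
  have a4 := abs_le.1 (hD x)
  linarith

lemma eq_cont {g : Fin m → Euc n × Ξ → Euc n} {φ : Fin m → Euc n × Ξ → ℝ}
    {B : Euc n → Matrix (Fin m) (Fin m) ℝ} (hB : GoodCoupling B)
    (lam : ℝ) (hg : ∀ i, Continuous (g i)) (hφ : ∀ i, Continuous (φ i))
    {u : Fin m → Euc n → ℝ} (hu : ∀ i, Continuous (u i)) (i : Fin m) :
    Continuous (fun q : Euc n × Euc n => lam * u i q.1 + (∑ j, B q.1 i j * u j q.1)
      + ham g φ i q.1 q.2) := by
  refine Continuous.add ?_ (ham_cont i (hg i) (hφ i))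
  have h1 : ∀ j, Continuous (fun q : Euc n × Euc n => B q.1 i j) :=
    fun j => (hB.1 i j).1.comp continuous_fst
  exact (continuous_const.mul ((hu i).comp continuous_fst)).add
    (continuous_finsetSum _ fun j _ => (h1 j).mul ((hu j).comp continuous_fst))

lemma memF_add {g : Fin m → Euc n × Ξ → Euc n} {L : Fin m → Euc n × Ξ → ℝ}
    (hgL : GoodData g L) (hcoer : Coercive g L)
    {B : Euc n → Matrix (Fin m) (Fin m) ℝ} (hB : GoodCoupling B) {lam : ℝ}
    {φ φ' : Fin m → Euc n × Ξ → ℝ} {u u' : Fin m → Euc n → ℝ}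
    (h : memF B lam g φ u) (h' : memF B lam g φ' u') :
    memF B lam g (fun i q => φ i q + φ' i q) (fun i x => u i x + u' i x) := by
  obtain ⟨hφ, hu, husc, hs⟩ := h
  obtain ⟨hφ', hu', husc', hs'⟩ := h'
  have hg : ∀ i, Continuous (g i) := fun i => (hgL.1 i).1
  refine ⟨fun i => ⟨(hφ i).1.add (hφ' i).1, fun x w ξ hw => ?_⟩, fun i => (hu i).add (hu' i),
    fun i => ⟨((hu i).add (hu' i)).upperSemicontinuous, fun x w hw => ?_⟩, ?_⟩
  · simp only [(hφ i).2 x w ξ hw, (hφ' i).2 x w ξ hw]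
  · simp only [(husc i).2 x w hw, (husc' i).2 x w hw]
  intro i ψ hψ hψp x hx
  obtain ⟨R, hR⟩ := coer_bound hgL hcoer hB lam hφ hu (fun i => (husc i).2) i
  obtain ⟨p, hp1, hp2⟩ := doubling (hu i) (hu' i) hψ hψp x hx
    (fun x p => lam * u i x + (∑ j, B x i j * u j x) + ham g φ i x p)
    (fun x p => lam * u' i x + (∑ j, B x i j * u' j x) + ham g φ' i x p)
    (eq_cont hB lam hg (fun i => (hφ i).1) hu i) (eq_cont hB lam hg (fun i => (hφ' i).1) hu' i)
    (fun ψ a b x c => hs i ψ a b x c) (fun ψ a b x c => hs' i ψ a b x c) R hR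
  have key : ham g (fun i q => φ i q + φ' i q) i x (gradient ψ x) ≤
      ham g φ i x (gradient ψ x + p) + ham g φ' i x (-p) := by
    refine ham_le i x _ _ fun ξ => ?_
    have a1 := le_ham i (hg i) (hφ i).1 x (gradient ψ x + p) ξ
    have a2 := le_ham i (hg i) (hφ' i).1 x (-p) ξ
    rw [inner_add_right] at a1
    rw [inner_neg_right] at a2
    linarith
  simp only [mul_add, Finset.sum_add_distrib]
  linarith

lemma memF_smul {g : Fin m → Euc n × Ξ → Euc n} (hg : ∀ i, Continuous (g i))
    {B : Euc n → Matrix (Fin m) (Fin m) ℝ} {lam : ℝ}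
    {φ : Fin m → Euc n × Ξ → ℝ} {u : Fin m → Euc n → ℝ}
    (h : memF B lam g φ u) {c : ℝ} (hc : 0 < c) :
    memF B lam g (fun i q => c * φ i q) (fun i x => c * u i x) := by
  obtain ⟨hφ, hu, husc, hs⟩ := h
  refine ⟨fun i => ⟨continuous_const.mul (hφ i).1, fun x w ξ hw => ?_⟩,
    fun i => continuous_const.mul (hu i),
    fun i => ⟨(continuous_const.mul (hu i)).upperSemicontinuous, fun x w hw => ?_⟩, ?_⟩
  · simp only [(hφ i).2 x w ξ hw]
  · simp only [(husc i).2 x w hw]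
  intro i ψ hψ hψp x hx
  have h1 := hs i (fun t => c⁻¹ * ψ t) (contDiff_const.mul hψ)
    (fun x w hw => by simp only [hψp x w hw]) x (by
      filter_upwards [hx] with y hy
      have := mul_le_mul_of_nonneg_left hy (inv_pos.2 hc).le
      simp only [mul_sub, inv_mul_cancel_left₀ hc.ne'] at this
      exact this)
  have h2 : gradient (fun t => c⁻¹ * ψ t) x = c⁻¹ • gradient ψ x := by
    apply HasGradientAt.gradient
    rw [hasGradientAt_iff_hasFDerivAt]
    refine ((grad_has hψ x).hasFDerivAt.const_mul c⁻¹).congr_fderiv ?_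
    ext v
    simp
  rw [h2] at h1
  have key : ham g (fun i q => c * φ i q) i x (gradient ψ x) ≤
      c * ham g φ i x (c⁻¹ • gradient ψ x) := by
    refine ham_le i x _ _ fun ξ => ?_
    have a1 := mul_le_mul_of_nonneg_left
      (le_ham i (hg i) (hφ i).1 x (c⁻¹ • gradient ψ x) ξ) hc.le
    rw [inner_smul_right, mul_sub, mul_neg, mul_inv_cancel_left₀ hc.ne'] at a1
    exact a1
  have h3 := mul_nonpos_of_nonneg_of_nonpos hc.le h1
  have h4 : ∑ j, B x i j * (c * u j x) = c * ∑ j, B x i j * u j x := by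
    rw [Finset.mul_sum]; exact Finset.sum_congr rfl fun j _ => by ring
  simp only [h4]
  nlinarith

lemma memF_mono {g : Fin m → Euc n × Ξ → Euc n} (hg : ∀ i, Continuous (g i))
    {B : Euc n → Matrix (Fin m) (Fin m) ℝ} {lam : ℝ}
    {φ φ' : Fin m → Euc n × Ξ → ℝ} {u : Fin m → Euc n → ℝ}
    (h : memF B lam g φ u) (hφ' : ∀ i, Continuous (φ' i) ∧ TorusFun2 (φ' i))
    (hle : ∀ i q, φ i q ≤ φ' i q) : memF B lam g φ' u := by
  obtain ⟨hφ, hu, husc, hs⟩ := h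
  refine ⟨hφ', hu, husc, fun i ψ hψ hψp x hx => ?_⟩
  have h1 := hs i ψ hψ hψp x hx
  have : ham g φ' i x (gradient ψ x) ≤ ham g φ i x (gradient ψ x) := by
    refine ham_le i x _ _ fun ξ => ?_
    have a1 := le_ham i (hg i) (hφ i).1 x (gradient ψ x) ξ
    have := hle i (x, ξ)
    linarith
  linarith

lemma rho_cont {B : Euc n → Matrix (Fin m) (Fin m) ℝ} (hB : GoodCoupling B) (i : Fin m) :
    Continuous (rhoB B i) := by
  unfold rhoB
  exact continuous_finsetSum _ fun j _ => (hB.1 i j).1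

lemma rho_per {B : Euc n → Matrix (Fin m) (Fin m) ℝ} (hB : GoodCoupling B) (i : Fin m) :
    TorusFun (rhoB B i) := by
  intro x w hw
  exact Finset.sum_congr rfl fun j _ => (hB.1 i j).2 x w hw

lemma rho_nonneg {B : Euc n → Matrix (Fin m) (Fin m) ℝ} (hB : GoodCoupling B) (i : Fin m)
    (x : Euc n) : 0 ≤ rhoB B i x := by
  simpa [rhoB] using hB.2 x (fun _ => 1) i (fun _ => le_rfl) zero_le_one

lemma memF_const {g : Fin m → Euc n × Ξ → Euc n}
    {B : Euc n → Matrix (Fin m) (Fin m) ℝ} (hB : GoodCoupling B) {lam : ℝ} (c : ℝ) :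
    memF B lam g (fun i q => (lam + rhoB B i q.1) * c) (fun _ _ => c) := by
  refine ⟨fun i => ⟨?_, fun x w ξ hw => ?_⟩, fun i => continuous_const,
    fun i => ⟨continuous_const.upperSemicontinuous, fun _ _ _ => rfl⟩, ?_⟩
  · have := rho_cont hB i
    fun_prop
  · simp only [rho_per hB i x w hw]
  intro i ψ hψ hψp x hx
  have h0 : gradient ψ x = 0 := by
    have : IsLocalMin ψ x := by
      filter_upwards [hx] with y hy
      linarith
    unfold gradient
    rw [this.fderiv_eq_zero]; simp
  have : ham g (fun i q => (lam + rhoB B i q.1) * c) i x (gradient ψ x) ≤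
      - ((lam + rhoB B i x) * c) := by
    refine ham_le i x _ _ fun ξ => ?_
    simp [h0]
  rw [← Finset.sum_mul]
  change _ + rhoB B i x * c + _ ≤ 0
  linarith

lemma memF_bound (hm : 0 < m) {g : Fin m → Euc n × Ξ → Euc n} (hg : ∀ i, Continuous (g i))
    {B : Euc n → Matrix (Fin m) (Fin m) ℝ} (hB : GoodCoupling B) {lam : ℝ} (hlam : 0 < lam)
    {φ : Fin m → Euc n × Ξ → ℝ} {u : Fin m → Euc n → ℝ}
    (h : memF B lam g φ u) (C : ℝ) (hC : ∀ i q, φ i q ≤ (lam + rhoB B i q.1) * C)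
    (k : Fin m) (z : Euc n) : u k z ≤ C := by
  obtain ⟨hφ, hu, husc, hs⟩ := h
  obtain ⟨i, x, hmax⟩ := periodic_argmax hm u hu fun i => (husc i).2
  by_contra hcon
  have hpos : 0 < u i x - C := by linarith [hmax k z]
  have h1 := hs i (fun _ => 0) contDiff_const (fun _ _ _ => rfl) x
    (Eventually.of_forall fun y => by simpa using hmax i y)
  obtain ⟨ξ⟩ := ‹Nonempty Ξ›
  have h2 := le_ham i (hg i) (hφ i).1 x (gradient (fun _ => (0 : ℝ)) x) ξ
  have h0 : gradient (fun _ : Euc n => (0 : ℝ)) x = 0 := by simp [gradient]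
  rw [h0] at h1 h2
  simp only [inner_zero_right, neg_zero, zero_sub] at h2
  have h3 := hC i (x, ξ)
  have h4 := hB.2 x (fun j => u j x - C) i (fun j => by simpa using hmax j x) hpos.le
  simp only [mul_sub, Finset.sum_sub_distrib, ← Finset.sum_mul] at h4
  change 0 ≤ _ - rhoB B i x * C at h4
  simp only at h3
  nlinarith

lemma comparison (hm : 0 < m) {g : Fin m → Euc n × Ξ → Euc n} {L : Fin m → Euc n × Ξ → ℝ}
    (hgL : GoodData g L) (hcoer : Coercive g L)
    {B : Euc n → Matrix (Fin m) (Fin m) ℝ} (hB : GoodCoupling B) {lam : ℝ} (hlam : 0 < lam)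
    {u v : Fin m → Euc n → ℝ} (h : memF B lam g L u) (hv : IsSol B lam g L (fun _ => 0) v)
    (k : Fin m) (z : Euc n) : u k z ≤ v k z := by
  obtain ⟨hφ, hu, husc, hs⟩ := h
  obtain ⟨hvc, -, hvp, hvs⟩ := hv
  have hg : ∀ i, Continuous (g i) := fun i => (hgL.1 i).1
  obtain ⟨i, x, hmax⟩ := periodic_argmax hm (fun i x => u i x - v i x)
    (fun i => (hu i).sub (hvc i))
    (fun i x w hw => by simp only [(husc i).2 x w hw, (hvp i).2 x w hw])
  by_contra hcon
  have hpos : 0 < u i x - v i x := by linarith [hmax k z]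
  obtain ⟨R, hR⟩ := coer_bound hgL hcoer hB lam hφ hu (fun i => (husc i).2) i
  have hcF := eq_cont hB lam hg (fun i => (hφ i).1) hvc i
  obtain ⟨p, hp1, hp2⟩ := doubling (hu i) (hvc i).neg
    (contDiff_const (c := (0 : ℝ))) (fun _ _ _ => rfl) x
    (Eventually.of_forall fun y => by have := hmax i y; simp only [Pi.neg_apply]; linarith)
    (fun x p => lam * u i x + (∑ j, B x i j * u j x) + ham g L i x p)
    (fun x p => -(lam * v i x + (∑ j, B x i j * v j x) + ham g L i x (-p)))
    (eq_cont hB lam hg (fun i => (hφ i).1) hu i)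
    (hcF.comp (continuous_fst.prodMk continuous_snd.neg)).neg
    (fun ψ a b x c => hs i ψ a b x c) (fun ψ a b x c => by
      have h1 := hvs i (fun t => -ψ t) a.neg (fun x w hw => by simp only [b x w hw]) x (by
        filter_upwards [c] with y hy
        simp only [Pi.neg_apply] at hy
        linarith)
      have h2 : gradient (fun t => -ψ t) x = - gradient ψ x := by
        apply HasGradientAt.gradient
        rw [hasGradientAt_iff_hasFDerivAt]
        refine ((grad_has a x).hasFDerivAt.neg).congr_fderiv ?_
        ext v
        simp
      rw [h2] at h1
      linarith) R hR
  have h0 : gradient (fun _ : Euc n => (0 : ℝ)) x = 0 := by simp [gradient]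
  rw [h0, zero_add] at hp1
  rw [neg_neg] at hp2
  have h4 := hB.2 x (fun j => u j x - v j x) i (fun j => by simpa using hmax j x) hpos.le
  simp only [mul_sub, Finset.sum_sub_distrib] at h4
  nlinarith

end hamLemmas

lemma hb_lemma {E : Type*} [AddCommGroup E] [Module ℝ E] (S : E → Set ℝ)
    (hne : ∀ f, (S f).Nonempty) (hbd : ∀ f, BddAbove (S f))
    (hadd : ∀ f f', ∀ s ∈ S f, ∀ t ∈ S f', s + t ∈ S (f + f'))
    (hsm : ∀ f, ∀ c : ℝ, 0 < c → ∀ s ∈ S f, c * s ∈ S (c • f))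
    (h0 : ∀ s ∈ S 0, s ≤ 0) (e : E) (w : ℝ) (hw : w ∈ S e) (hw' : ∀ s ∈ S e, s ≤ w) :
    ∃ G : E →ₗ[ℝ] ℝ, (∀ f, ∀ s ∈ S f, s ≤ G f) ∧ G e = w := by
  have h00 : ∀ t ∈ S 0, 0 ≤ t → t = 0 := fun t ht h => le_antisymm (h0 t ht) h
  have hq : ∀ f, ∀ c : ℝ, 0 < c → sSup (S (c • f)) = c * sSup (S f) := by
    have hle : ∀ f, ∀ c : ℝ, 0 < c → c * sSup (S f) ≤ sSup (S (c • f)) := by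
      intro f c hc
      rw [← le_div_iff₀' hc]
      refine csSup_le (hne f) fun s hs => ?_
      rw [le_div_iff₀' hc]
      exact le_csSup (hbd _) (hsm f c hc s hs)
    intro f c hc
    refine le_antisymm ?_ (hle f c hc)
    have := hle (c • f) c⁻¹ (inv_pos.2 hc)
    rw [smul_smul, inv_mul_cancel₀ hc.ne', one_smul] at this
    rwa [inv_mul_le_iff₀ hc] at this
  have hqa : ∀ f f', sSup (S f) + sSup (S f') ≤ sSup (S (f + f')) := by
    intro f f'
    have : sSup (S f) ≤ sSup (S (f + f')) - sSup (S f') := by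
      refine csSup_le (hne f) fun s hs => ?_
      have : sSup (S f') ≤ sSup (S (f + f')) - s := by
        refine csSup_le (hne f') fun t ht => ?_
        have := le_csSup (hbd _) (hadd f f' s hs t ht)
        linarith
      linarith
    linarith
  have hq0 : sSup (S 0) = 0 := by
    have := hq 0 2 two_pos
    rw [smul_zero] at this
    linarith
  have hqe : sSup (S e) = w := le_antisymm (csSup_le ⟨w, hw⟩ hw') (le_csSup (hbd _) hw)
  have H : ∀ c : ℝ, c • e = 0 → (RingHom.id ℝ) c • w = 0 := by
    intro c hc
    rcases smul_eq_zero.1 hc with h | h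
    · simp [h]
    · rw [h, hq0] at hqe
      simp [← hqe]
  obtain ⟨G, hG1, hG2⟩ := exists_extension_of_le_sublinear
    (LinearPMap.mkSpanSingleton' e w H) (fun f => -sSup (S (-f)))
    (fun c hc x => by
      simp only [← smul_neg, hq _ c hc]; ring)
    (fun x y => by
      have := hqa (-x) (-y)
      rw [neg_add]
      linarith)
    (by
      rintro ⟨x, hx⟩
      obtain ⟨c, rfl⟩ := Submodule.mem_span_singleton.1 hx
      rw [LinearPMap.mkSpanSingleton'_apply]
      simp only [RingHom.id_apply, smul_eq_mul]
      rcases lt_trichotomy c 0 with hc | hc | hc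
      · rw [← neg_smul, hq _ _ (neg_pos.2 hc), hqe]; linarith
      · simp [hc, hq0]
      · have h1 := hqa (c • e) (-(c • e))
        rw [add_neg_cancel, hq0, hq _ _ hc, hqe] at h1
        linarith)
  refine ⟨G, fun f s hs => ?_, ?_⟩
  · have h1 := hG2 (-f)
    rw [neg_neg, map_neg] at h1
    have := le_csSup (hbd f) hs
    linarith
  · have := hG1 ⟨e, Submodule.mem_span_singleton_self e⟩
    exact this.trans (LinearPMap.mkSpanSingleton'_apply_self e w H _)

theorem stmt9 {n m : ℕ} (hn : 0 < n) (hm : 0 < m)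
    {Ξ : Type*} [MetricSpace Ξ] [CompactSpace Ξ] [Nonempty Ξ]
    [MeasurableSpace Ξ] [BorelSpace Ξ]
    (g : Fin m → Euc n × Ξ → Euc n) (L : Fin m → Euc n × Ξ → ℝ)
    (hgL : GoodData g L) (hcoer : Coercive g L)
    (B : Euc n → Matrix (Fin m) (Fin m) ℝ) (hB : GoodCoupling B)
    (lam : ℝ) (hlam : 0 < lam) (z : Euc n) (k : Fin m)
    (v : Fin m → Euc n → ℝ) (hv : IsSol B lam g L (fun _ => 0) v) :
    ∃ μ : Fin m → Measure (Euc n × Ξ), memPzk B lam g z k μ ∧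
      v k z = (∑ i, ∫ q, (lam + rhoB B i q.1)⁻¹ * L i q ∂(μ i)) ∧
      ∀ μ' : Fin m → Measure (Euc n × Ξ), memPzk B lam g z k μ' →
        v k z ≤ ∑ i, ∫ q, (lam + rhoB B i q.1)⁻¹ * L i q ∂(μ' i) := by
  have hg : ∀ i, Continuous (g i) := fun i => (hgL.1 i).1
  have hmF : memF B lam g L v := ⟨hgL.2, hv.1, hv.2.1⟩
  have hpos : ∀ i x, 0 < lam + rhoB B i x := fun i x => by linarith [rho_nonneg hB i x]
  suffices hmain : ∃ μ : Fin m → Measure (Euc n × Ξ), memPzk B lam g z k μ ∧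
      v k z = (∑ i, ∫ q, (lam + rhoB B i q.1)⁻¹ * L i q ∂(μ i)) by
    obtain ⟨μ, h1, h2⟩ := hmain
    exact ⟨μ, h1, h2, fun μ' h => h.2 L v hmF⟩
  haveI hcK : CompactSpace (cubeK n) := isCompact_iff_compactSpace.1 cubeK_compact
  haveI : SecondCountableTopology Ξ := UniformSpace.secondCountable_of_separable Ξ
  let X := Fin m × (cubeK n × Ξ)
  haveI : Nonempty X := ⟨(k, ⟨0, cubeK_zero⟩, Classical.arbitrary Ξ)⟩
  let mkE : (f : X → ℝ) → Continuous f → CompactlySupportedContinuousMap X ℝ := fun f hf =>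
    ⟨⟨f, hf⟩, HasCompactSupport.of_compactSpace f⟩
  -- weighted restriction of a family to the cube
  let res : (Fin m → Euc n × Ξ → ℝ) → X → ℝ := fun φ q =>
    (lam + rhoB B q.1 q.2.1)⁻¹ * φ q.1 (q.2.1, q.2.2)
  have hresc : ∀ φ : Fin m → Euc n × Ξ → ℝ, (∀ i, Continuous (φ i)) → Continuous (res φ) := by
    intro φ hφ
    rw [continuous_prod_of_discrete_left]
    intro i
    have h1 : Continuous (fun y : cubeK n × Ξ => lam + rhoB B i y.1) :=
      continuous_const.add ((rho_cont hB i).comp (continuous_subtype_val.comp continuous_fst))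
    have h2 : Continuous (fun y : cubeK n × Ξ => φ i (y.1, y.2)) :=
      (hφ i).comp ((continuous_subtype_val.comp continuous_fst).prodMk continuous_snd)
    exact (h1.inv₀ fun y => (hpos i y.1).ne').mul h2
  let S : CompactlySupportedContinuousMap X ℝ → Set ℝ := fun f =>
    {t | ∃ φ u, memF B lam g φ u ∧ (∀ q : X, res φ q ≤ f q) ∧ t = u k z}
  have hglob : ∀ φ, (∀ i, TorusFun2 (φ i)) → ∀ C : ℝ, (∀ q : X, res φ q ≤ C) →
      ∀ i q, φ i q ≤ (lam + rhoB B i q.1) * C := by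
    intro φ hφ C hC i q
    obtain ⟨w, hw, hq⟩ := cubeK_shift q.1
    have h1 := hC (i, ⟨q.1 + w, hq⟩, q.2)
    simp only [res] at h1
    rw [rho_per hB i _ w hw, hφ i _ w _ hw, inv_mul_le_iff₀ (hpos i _)] at h1
    exact h1
  obtain ⟨G, hG, hGe⟩ := hb_lemma S
    (by
      intro f
      obtain ⟨q0, -, hq0⟩ := isCompact_univ.exists_isMinOn (Set.univ_nonempty (α := X))
        f.continuous.continuousOn
      refine ⟨_, _, _, memF_const hB (f q0), fun q => ?_, rfl⟩
      simp only [res]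
      rw [inv_mul_cancel_left₀ (hpos _ _).ne']
      exact hq0 (Set.mem_univ q))
    (by
      intro f
      obtain ⟨q0, -, hq0⟩ := isCompact_univ.exists_isMaxOn (Set.univ_nonempty (α := X))
        f.continuous.continuousOn
      refine ⟨f q0, ?_⟩
      rintro t ⟨φ, u, hF, hle, rfl⟩
      exact memF_bound hm hg hB hlam hF _ (hglob φ (fun i => (hF.1 i).2) _
        fun q => (hle q).trans (hq0 (Set.mem_univ q))) k z)
    (by
      rintro f f' s ⟨φ, u, hF, hle, rfl⟩ t ⟨φ', u', hF', hle', rfl⟩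
      refine ⟨_, _, memF_add hgL hcoer hB hF hF', fun q => ?_, rfl⟩
      have h1 := hle q
      have h2 := hle' q
      simp only [res] at h1 h2 ⊢
      rw [mul_add]
      exact add_le_add h1 h2)
    (by
      rintro f c hc s ⟨φ, u, hF, hle, rfl⟩
      refine ⟨_, _, memF_smul hg hF hc, fun q => ?_, rfl⟩
      have h1 := mul_le_mul_of_nonneg_left (hle q) hc.le
      simp only [res] at h1 ⊢
      rw [mul_left_comm]
      exact h1)
    (by
      rintro s ⟨φ, u, hF, hle, rfl⟩
      exact memF_bound hm hg hB hlam hF _ (hglob φ (fun i => (hF.1 i).2) 0 hle) k z)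
    (mkE (res L) (hresc L fun i => (hgL.2 i).1)) (v k z)
    ⟨L, v, hmF, fun q => le_rfl, rfl⟩
    (by
      rintro s ⟨φ, u, hF, hle, rfl⟩
      refine comparison hm hgL hcoer hB hlam (memF_mono hg hF hgL.2 fun i q => ?_) hv k z
      obtain ⟨w, hw, hq⟩ := cubeK_shift q.1
      have h1 : (lam + rhoB B i (q.1 + w))⁻¹ * φ i (q.1 + w, q.2) ≤
          (lam + rhoB B i (q.1 + w))⁻¹ * L i (q.1 + w, q.2) := hle (i, ⟨q.1 + w, hq⟩, q.2)
      have h2 := le_of_mul_le_mul_left h1 (inv_pos.2 (hpos i _))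
      rwa [(hF.1 i).2 _ w _ hw, (hgL.2 i).2 _ w _ hw] at h2)
  have hGpos : ∀ f, 0 ≤ f → 0 ≤ G f := by
    intro f hf
    refine hG f 0 ⟨_, _, memF_const hB 0, fun q => ?_, rfl⟩
    simp only [res, mul_zero]
    exact hf q
  let Λ : CompactlySupportedContinuousMap X ℝ →ₚ[ℝ] ℝ := PositiveLinearMap.mk₀ G hGpos
  let ν : Measure X := RealRMK.rieszMeasure Λ
  have hν : ∀ f : CompactlySupportedContinuousMap X ℝ, ∫ q, f q ∂ν = G f := fun f =>
    RealRMK.integral_rieszMeasure Λ f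
  let pr : X → Euc n × Ξ := fun q => (q.2.1, q.2.2)
  have hprc : Continuous pr := by fun_prop
  let sl : Fin m → Set X := fun i => {q | q.1 = i}
  have hsl : ∀ i, MeasurableSet (sl i) := fun i => measurable_fst (measurableSet_singleton i)
  let μ : Fin m → Measure (Euc n × Ξ) := fun i => (ν.restrict (sl i)).map pr
  have hμ : ∀ h : Fin m → Euc n × Ξ → ℝ, (∀ i, Continuous (h i)) →
      ∑ i, ∫ q, h i q ∂(μ i) = ∫ q, h q.1 (pr q) ∂ν := by
    intro h hh
    have hc : Continuous (fun q : X => h q.1 (pr q)) := by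
      rw [continuous_prod_of_discrete_left]
      intro i
      exact (hh i).comp ((continuous_subtype_val.comp continuous_fst).prodMk continuous_snd)
    have hintg : Integrable (fun q : X => h q.1 (pr q)) ν :=
      hc.integrable_of_hasCompactSupport (HasCompactSupport.of_compactSpace _)
    have hU : (⋃ i, sl i) = Set.univ := by ext q; simp [sl]
    rw [← setIntegral_univ, ← hU, integral_iUnion_fintype hsl ?_ fun i => hintg.integrableOn]
    · refine Finset.sum_congr rfl fun i _ => ?_
      rw [integral_map hprc.aemeasurable (hh i).aestronglyMeasurable]
      refine setIntegral_congr_fun (hsl i) fun q hq => ?_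
      have hq : q.1 = i := hq
      simp only [hq]
    · intro i j hij
      refine Set.disjoint_left.2 fun q hq hq' => hij ?_
      exact (show q.1 = i from hq).symm.trans hq'
  have hμφ : ∀ φ : Fin m → Euc n × Ξ → ℝ, ∀ hφ : (∀ i, Continuous (φ i)),
      ∑ i, ∫ q, (lam + rhoB B i q.1)⁻¹ * φ i q ∂(μ i) = G (mkE (res φ) (hresc φ hφ)) := by
    intro φ hφ
    rw [hμ (fun i q => (lam + rhoB B i q.1)⁻¹ * φ i q), ← hν]
    · rfl
    · intro i
      have h1 : Continuous (fun y : Euc n × Ξ => lam + rhoB B i y.1) :=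
        continuous_const.add ((rho_cont hB i).comp continuous_fst)
      exact (h1.inv₀ fun y => (hpos i y.1).ne').mul (hφ i)
  have hfin : ∀ i, IsFiniteMeasure (μ i) := fun i => by infer_instance
  refine ⟨μ, ⟨⟨hfin, ?_⟩, fun φ u hF => ?_⟩, ?_⟩
  · have h1 : ∑ i, (μ i Set.univ).toReal = G (mkE (fun _ => 1) continuous_const) := by
      rw [← hν]
      have := hμ (fun _ _ => 1) (fun _ => continuous_const)
      simp only [integral_const, smul_eq_mul, mul_one, Measure.real] at this
      rw [this]
      simp [mkE, Measure.real]
    rw [h1]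
    apply le_antisymm
    · have := hG (-(mkE (fun _ => 1) continuous_const)) (-1)
        ⟨_, _, memF_const hB (-1), fun q => ?_, rfl⟩
      · rw [map_neg] at this
        linarith
      · simp only [res]
        rw [inv_mul_cancel_left₀ (hpos _ _).ne']
        exact le_rfl
    · refine hG _ 1 ⟨_, _, memF_const hB 1, fun q => ?_, rfl⟩
      simp only [res]
      rw [inv_mul_cancel_left₀ (hpos _ _).ne']
      exact le_rfl
  · rw [hμφ φ fun i => (hF.1 i).1]
    exact hG _ _ ⟨φ, u, hF, fun q => le_rfl, rfl⟩
  · rw [hμφ L fun i => (hgL.2 i).1, hGe]
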